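/- arXiv:2311.00352 — 2 statements merged into one kernel-verified Lean document; each statement's English description precedes it below -/
import Mathlib

section
/- Let G be a locally graded biminimal non-nilpotent group. If G has a finitely generated non-nilpotent subgroup, then G is finite. -/
/-- A group is *minimal non-nilpotent* if it is not nilpotent but every proper
subgroup of it is nilpotent. -/
def MinimalNonNilpotent (G : Type*) [Group G] : Prop :=
  ¬ Group.IsNilpotent G ∧ ∀ H : Subgroup G, H ≠ ⊤ → Group.IsNilpotent H

/-- A group is *biminimal non-nilpotent* if it is neither nilpotent nor minimal
non-nilpotent, but every proper subgroup of it is nilpotent or minimal non-nilpotent. -/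
def BiminimalNonNilpotent (G : Type*) [Group G] : Prop :=
  ¬ Group.IsNilpotent G ∧ ¬ MinimalNonNilpotent G ∧
    ∀ H : Subgroup G, H ≠ ⊤ → (Group.IsNilpotent H ∨ MinimalNonNilpotent H)

/-- A group is *para-Nil-Hamiltonian* if it is not nilpotent and every non-normal
subgroup of it is either nilpotent or minimal non-nilpotent. -/
def ParaNilHamiltonian (G : Type*) [Group G] : Prop :=
  ¬ Group.IsNilpotent G ∧
    ∀ H : Subgroup G, ¬ H.Normal → (Group.IsNilpotent H ∨ MinimalNonNilpotent H)

/-- A group is *meta-Nil-Hamiltonian* if every non-nilpotent subgroup of it is normal. -/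
def MetaNilHamiltonian (G : Type*) [Group G] : Prop :=
  ∀ H : Subgroup G, ¬ Group.IsNilpotent H → H.Normal

/-- A group is *locally graded* if every non-trivial finitely generated subgroup of it
contains a proper subgroup of finite index. -/
def LocallyGraded (G : Type*) [Group G] : Prop :=
  ∀ H : Subgroup G, H ≠ ⊥ → Group.FG H → ∃ K : Subgroup H, K ≠ ⊤ ∧ K.FiniteIndex

/-- A group is abelian if its multiplication commutes. -/
def Abelian (G : Type*) [Group G] : Prop := ∀ a b : G, a * b = b * a

/-- A group is *minimal non-abelian* if it is not abelian but every proper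
subgroup of it is abelian. -/
def MinimalNonAbelian (G : Type*) [Group G] : Prop :=
  ¬ Abelian G ∧ ∀ H : Subgroup G, H ≠ ⊤ → Abelian H

/-- A group is *biminimal non-abelian* if it is neither abelian nor minimal non-abelian,
but every proper subgroup of it is abelian or minimal non-abelian. -/
def BiminimalNonAbelian (G : Type*) [Group G] : Prop :=
  ¬ Abelian G ∧ ¬ MinimalNonAbelian G ∧
    ∀ H : Subgroup G, H ≠ ⊤ → (Abelian H ∨ MinimalNonAbelian H)

/-- A group is *parahamiltonian* if it is not abelian and every non-normal subgroup
of it is either abelian or minimal non-abelian. -/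
def Parahamiltonian (G : Type*) [Group G] : Prop :=
  ¬ Abelian G ∧ ∀ H : Subgroup G, ¬ H.Normal → (Abelian H ∨ MinimalNonAbelian H)

/-- A group is *locally nilpotent* if every finitely generated subgroup of it is nilpotent. -/
def LocallyNilpotent (G : Type*) [Group G] : Prop :=
  ∀ H : Subgroup G, Group.FG H → Group.IsNilpotent H

open Subgroup in
/-- Commutators with a product of two subgroups are controlled by commutators with the factors. -/
theorem commutator_sup_le {G : Type*} [Group G] {X M N Y : Subgroup G} [M.Normal] [Y.Normal]
    (hM : ⁅X, M⁆ ≤ Y) (hN : ⁅X, N⁆ ≤ Y) : ⁅X, M ⊔ N⁆ ≤ Y := by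
  rw [commutator_le] at *
  intro x hx g hg
  obtain ⟨m, hm, n, hn, rfl⟩ := mem_sup_of_normal_left.1 hg
  rw [commutatorElement_mul_right_eq_mul_conj]
  have := (inferInstance : Y.Normal).conj_mem _ (hN x hx n hn) m
  simpa [mul_assoc] using Y.mul_mem (hM x hx m hm) this

/-- The lower central series of `M`, shifted by one step so as to start from the whole group. -/
def shiftedLowerCentralSeries {G : Type*} [Group G] (M : Subgroup G) : ℕ → Subgroup G
  | 0 => ⊤
  | i + 1 => M.lowerCentralSeries i

instance {G : Type*} [Group G] (M : Subgroup G) [M.Normal] (i : ℕ) :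
    (shiftedLowerCentralSeries M i).Normal := by
  cases i <;> unfold shiftedLowerCentralSeries <;> infer_instance

theorem commutator_shiftedLowerCentralSeries_le {G : Type*} [Group G] (M : Subgroup G) [M.Normal]
    (i : ℕ) : ⁅shiftedLowerCentralSeries M i, M⁆ ≤ shiftedLowerCentralSeries M (i + 1) := by
  cases i with
  | zero => exact Subgroup.commutator_le_right _ _
  | succ i => exact le_rfl

open Subgroup in
/-- **Fitting's theorem** for a group that is the product of two normal nilpotent subgroups. -/
theorem isNilpotent_of_sup_eq_top {G : Type*} [Group G] {M N : Subgroup G} [M.Normal] [N.Normal]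
    (hM : Group.IsNilpotent M) (hN : Group.IsNilpotent N) (h : M ⊔ N = ⊤) :
    Group.IsNilpotent G := by
  obtain ⟨c, hc⟩ := (isNilpotent_iff_lowerCentralSeries _).1 hM
  obtain ⟨d, hd⟩ := (isNilpotent_iff_lowerCentralSeries _).1 hN
  have key : ∀ k i j, c + d + 2 ≤ i + j + k →
      shiftedLowerCentralSeries M i ⊓ shiftedLowerCentralSeries N j ≤
        (Subgroup.upperCentralSeries G k) := by
    intro k
    induction k with
    | zero =>
      intro i j hij
      rcases (by omega : c + 1 ≤ i ∨ d + 1 ≤ j) with hi | hj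
      · obtain ⟨i, rfl⟩ := Nat.exists_eq_add_of_le' hi
        have : M.lowerCentralSeries (i + c) ≤ ⊥ :=
          hc ▸ M.lowerCentralSeries_antitone (Nat.le_add_left c i)
        exact inf_le_left.trans (this.trans bot_le)
      · obtain ⟨j, rfl⟩ := Nat.exists_eq_add_of_le' hj
        have : N.lowerCentralSeries (j + d) ≤ ⊥ :=
          hd ▸ N.lowerCentralSeries_antitone (Nat.le_add_left d j)
        exact inf_le_right.trans (this.trans bot_le)
    | succ k ih =>
      intro i j hij x hx
      have hle : ⁅shiftedLowerCentralSeries M i ⊓ shiftedLowerCentralSeries N j, M ⊔ N⁆ ≤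
          Subgroup.upperCentralSeries G k := by
        refine commutator_sup_le (le_trans ?_ (ih (i + 1) j (by omega)))
          (le_trans ?_ (ih i (j + 1) (by omega)))
        · exact le_inf ((commutator_mono inf_le_left le_rfl).trans
              (commutator_shiftedLowerCentralSeries_le M i))
            ((commutator_mono inf_le_right le_rfl).trans (commutator_le_left _ _))
        · exact le_inf ((commutator_mono inf_le_left le_rfl).trans (commutator_le_left _ _))
            ((commutator_mono inf_le_right le_rfl).trans
              (commutator_shiftedLowerCentralSeries_le N j))
      rw [Subgroup.mem_upperCentralSeries_succ_iff]
      intro g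
      simpa [commutatorElement_def] using
        commutator_le.1 hle x hx g (h ▸ mem_top g)
  refine ⟨c + d + 2, top_le_iff.1 ((le_inf le_rfl le_rfl).trans (key (c + d + 2) 0 0 (by omega)))⟩

theorem finite_of_finite_of_finiteIndex {G : Type*} [Group G] (H : Subgroup G) [Finite H]
    [H.FiniteIndex] : Finite G :=
  Nat.finite_of_card_ne_zero (by
    rw [← H.card_mul_index]
    exact mul_ne_zero Nat.card_pos.ne' Subgroup.FiniteIndex.index_ne_zero)

open scoped IsMulCommutative in
theorem finite_of_finite_abelianization_of_finiteIndex_center {G : Type*} [Group G] [Group.FG G]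
    [(Subgroup.center G).FiniteIndex] [Finite (Abelianization G)] : Finite G := by
  have htors : IsMulTorsion (Subgroup.center G) := fun z ↦ by
    have h1 := (Abelianization.lift (MonoidHom.transferCenterPow G)).isOfFinOrder
      (isOfFinOrder_of_finite (Abelianization.of (z : G)))
    rw [Abelianization.lift_apply_of] at h1
    have h2 : MonoidHom.transferCenterPow G z = z ^ (Subgroup.center G).index :=
      Subtype.ext (by simp)
    rw [h2] at h1
    exact h1.of_pow Subgroup.FiniteIndex.index_ne_zero
  have : Finite (Subgroup.center G) := CommGroup.finite_of_fg_isMulTorsion _ htors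
  exact finite_of_finite_of_finiteIndex (Subgroup.center G)

/-- A finitely generated nilpotent group with finite abelianization is finite. -/
theorem finite_of_isNilpotent_of_finite_abelianization {G : Type*} [Group G]
    [hn : Group.IsNilpotent G] (hfg : Group.FG G) (hab : Finite (Abelianization G)) :
    Finite G := by
  revert hfg hab
  refine Group.nilpotent_center_quotient_ind
    (P := fun G _ _ ↦ Group.FG G → Finite (Abelianization G) → Finite G) G ?_ ?_
  · intros; infer_instance
  · intro G _ _ ih hfg hab
    have hsurj : Function.Surjective
        (Abelianization.map (QuotientGroup.mk' (Subgroup.center G))) := by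
      rintro ⟨⟨x⟩⟩
      exact ⟨Abelianization.of x, rfl⟩
    have := ih inferInstance (Finite.of_surjective _ hsurj)
    have : (Subgroup.center G).FiniteIndex := Subgroup.finiteIndex_of_finite_quotient
    exact finite_of_finite_abelianization_of_finiteIndex_center

/-- An infinite finitely generated commutative group maps onto the infinite cyclic group. -/
theorem exists_surjective_multiplicative_int {A : Type*} [CommGroup A] [Group.FG A]
    [Infinite A] : ∃ f : A →* Multiplicative ℤ, Function.Surjective f := by
  obtain ⟨n, ι, _, p, hp, e, ⟨φ⟩⟩ := AddCommGroup.equiv_free_prod_directSum_zmod (Additive A)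
  rcases n with _ | n
  · have (i : ι) : NeZero (p i ^ e i) := ⟨pow_ne_zero _ (hp i).ne_zero⟩
    have : Finite (DirectSum ι fun i ↦ ZMod (p i ^ e i)) :=
      Finite.of_equiv (∀ i, ZMod (p i ^ e i)) DFinsupp.equivFunOnFintype.symm
    have : Finite (Additive A) := Finite.of_equiv _ φ.symm.toEquiv
    exact (not_finite (Additive A)).elim
  · let g : Additive A →+ ℤ :=
      ((Finsupp.applyAddHom (0 : Fin (n + 1))).comp (AddMonoidHom.fst _ _)).comp φ.toAddMonoidHom
    refine ⟨AddMonoidHom.toMultiplicativeRight g, fun z ↦ ?_⟩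
    refine ⟨(φ.symm (Finsupp.single 0 z.toAdd, 0)).toMul, ?_⟩
    simp [g]

/-- A group whose finite index proper subgroups are nilpotent and which maps onto the infinite
cyclic group is nilpotent. -/
theorem isNilpotent_of_surjective_multiplicative_int {G : Type*} [Group G]
    (hG : ∀ H : Subgroup G, H ≠ ⊤ → H.FiniteIndex → Group.IsNilpotent H)
    (f : G →* Multiplicative ℤ) (hf : Function.Surjective f) : Group.IsNilpotent G := by
  let Z (n : ℕ) : Subgroup (Multiplicative ℤ) := Subgroup.zpowers (Multiplicative.ofAdd (n : ℤ))
  have hmem (n : ℕ) (z : ℤ) : Multiplicative.ofAdd z ∈ Z n ↔ (n : ℤ) ∣ z := by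
    simp only [Z, Subgroup.mem_zpowers_iff, ← ofAdd_zsmul, dvd_iff_exists_eq_mul_left,
      Multiplicative.ofAdd.injective.eq_iff, smul_eq_mul, eq_comm]
  have hnil (n : ℕ) (hn : 2 ≤ n) : Group.IsNilpotent ((Z n).comap f) := by
    refine hG _ (fun htop ↦ ?_) ?_
    · obtain ⟨g, hg⟩ := hf (Multiplicative.ofAdd 1)
      have h1 : g ∈ (Z n).comap f := htop ▸ Subgroup.mem_top g
      rw [Subgroup.mem_comap, hg, hmem] at h1
      have := Int.le_of_dvd one_pos h1
      omega
    · have : (Z n).FiniteIndex := by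
        have : Finite (Multiplicative ℤ ⧸ Z n) := by
          apply CommGroup.finite_of_fg_isMulTorsion
          intro q
          induction q using QuotientGroup.induction_on with
          | H z =>
            refine isOfFinOrder_iff_pow_eq_one.2 ⟨n, by omega, ?_⟩
            rw [← QuotientGroup.mk_pow, QuotientGroup.eq_one_iff, ← ofAdd_toAdd (z ^ n), hmem]
            simp
        exact Subgroup.finiteIndex_of_finite_quotient
      exact ⟨by rw [Subgroup.index_comap_of_surjective _ hf]; exact this.index_ne_zero⟩
  refine isNilpotent_of_sup_eq_top (hnil 2 le_rfl) (hnil 3 (by norm_num)) ?_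
  refine top_le_iff.1 fun g _ ↦ ?_
  obtain ⟨x, hx⟩ := hf (Multiplicative.ofAdd (3 * (f g).toAdd))
  have h3 : x ∈ (Z 3).comap f := by
    rw [Subgroup.mem_comap, hx, hmem]
    simp
  have h2 : g * x⁻¹ ∈ (Z 2).comap f := by
    rw [Subgroup.mem_comap, ← ofAdd_toAdd (f (g * x⁻¹)), hmem, map_mul, map_inv, hx]
    exact ⟨-(f g).toAdd, by simp; ring⟩
  simpa using mul_mem (Subgroup.mem_sup_left h2 : _ ∈ (Z 2).comap f ⊔ (Z 3).comap f)
    (Subgroup.mem_sup_right h3)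

section IsMulCommutative

open scoped IsMulCommutative

/-- The subgroup of `m`-th powers of elements of a commutative subgroup. -/
def powSubgroup {G : Type*} [Group G] (A : Subgroup G) [IsMulCommutative A] (m : ℕ) :
    Subgroup G :=
  (powMonoidHom m : A →* A).range.map A.subtype

section powSubgroup

variable {G : Type*} [Group G] (A : Subgroup G) [IsMulCommutative A]

theorem mem_powSubgroup {m : ℕ} {g : G} : g ∈ powSubgroup A m ↔ ∃ a ∈ A, a ^ m = g := by
  simp only [powSubgroup, Subgroup.mem_map, MonoidHom.mem_range, Subgroup.subtype_apply]
  constructor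
  · rintro ⟨_, ⟨a, rfl⟩, rfl⟩
    exact ⟨a, a.2, rfl⟩
  · rintro ⟨a, ha, rfl⟩
    exact ⟨_, ⟨⟨a, ha⟩, rfl⟩, rfl⟩

theorem powSubgroup_relIndex (m : ℕ) :
    (powSubgroup A m).relIndex A = Nat.card (A ⧸ (powMonoidHom m : A →* A).range) := by
  rw [powSubgroup, Subgroup.relIndex, Subgroup.subgroupOf,
    Subgroup.comap_map_eq_self_of_injective A.subtype_injective]
  rfl

theorem powSubgroup_le (m : ℕ) : powSubgroup A m ≤ A :=
  Subgroup.map_subtype_le _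

instance [A.Normal] (m : ℕ) : (powSubgroup A m).Normal := by
  refine ⟨fun x hx g ↦ ?_⟩
  obtain ⟨a, ha, rfl⟩ := (mem_powSubgroup A).1 hx
  exact (mem_powSubgroup A).2 ⟨g * a * g⁻¹, (inferInstance : A.Normal).conj_mem a ha g, conj_pow⟩

theorem powSubgroup_relIndex_ne_zero [Group.FG A] {m : ℕ} (hm : m ≠ 0) :
    (powSubgroup A m).relIndex A ≠ 0 := by
  have : Finite (A ⧸ (powMonoidHom m : A →* A).range) :=
    CommGroup.finite_of_fg_isMulTorsion _ (CommGroup.isMulTorsion_quotient_range_powMonoidHom A hm)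
  rw [powSubgroup_relIndex]
  exact Nat.card_pos.ne'

theorem exists_powSubgroup_relIndex_eq [Group.FG A] {p : ℕ} (hp : p.Prime) :
    ∃ k, (powSubgroup A p).relIndex A = p ^ k := by
  have : Fact p.Prime := ⟨hp⟩
  have : Finite (A ⧸ (powMonoidHom p : A →* A).range) :=
    CommGroup.finite_of_fg_isMulTorsion _
      (CommGroup.isMulTorsion_quotient_range_powMonoidHom A hp.ne_zero)
  have hP : IsPGroup p (A ⧸ (powMonoidHom p : A →* A).range) := by
    intro q
    induction q using QuotientGroup.induction_on with
    | H a =>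
      refine ⟨1, ?_⟩
      rw [← QuotientGroup.mk_pow, QuotientGroup.eq_one_iff]
      simp
  obtain ⟨k, hk⟩ := IsPGroup.iff_card.1 hP
  exact ⟨k, by rw [powSubgroup_relIndex, hk]⟩

theorem powSubgroup_ne_self [Group.FG A] [Infinite A] {p : ℕ} (hp : p.Prime) :
    powSubgroup A p ≠ A := by
  intro h
  obtain ⟨f, hf⟩ := exists_surjective_multiplicative_int (A := A)
  obtain ⟨a, ha⟩ := hf (Multiplicative.ofAdd 1)
  obtain ⟨b, hb, hba⟩ := (mem_powSubgroup A).1 (h.ge a.2)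
  have hba : (⟨b, hb⟩ : A) ^ p = a := Subtype.ext hba
  have h1 : (p : ℤ) * (f ⟨b, hb⟩).toAdd = 1 := by
    rw [← hba, map_pow] at ha
    simpa using congrArg Multiplicative.toAdd ha
  have := Int.le_of_dvd one_pos (Dvd.intro _ h1)
  have := hp.two_le
  omega

/-- A finitely generated commutative group has a torsion-free subgroup of powers. -/
theorem exists_powSubgroup_isMulTorsionFree [Group.FG A] :
    ∃ e ≠ 0, ∀ x ∈ powSubgroup A e, IsOfFinOrder x → x = 1 := by
  have hfin : Finite (CommGroup.torsion A) := by
    have : Group.FG (CommGroup.torsion A) := by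
      have : IsNoetherian ℤ (Additive A) :=
        isNoetherian_of_isNoetherianRing_of_finite ℤ (Additive A)
      rw [Group.fg_iff_subgroup_fg, Subgroup.fg_iff_add_fg,
        ← AddSubgroup.toIntSubmodule_toAddSubgroup (CommGroup.torsion A).toAddSubgroup,
        ← Submodule.fg_iff_addSubgroup_fg]
      exact IsNoetherian.noetherian _
    refine CommGroup.finite_of_fg_isMulTorsion _ fun x ↦ ?_
    exact (CommGroup.torsion A).subtype_injective.isOfFinOrder_iff.1 x.2
  refine ⟨Nat.card (CommGroup.torsion A), Nat.card_pos.ne', fun x hx hx1 ↦ ?_⟩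
  obtain ⟨a, ha, rfl⟩ := (mem_powSubgroup A).1 hx
  have h1 : IsOfFinOrder (⟨a, ha⟩ : A) :=
    A.subtype_injective.isOfFinOrder_iff.1 (hx1.of_pow Nat.card_pos.ne')
  exact congrArg (fun t : CommGroup.torsion A ↦ ((t : A) : G))
    (pow_card_eq_one' (x := (⟨⟨a, ha⟩, h1⟩ : CommGroup.torsion A)))

end powSubgroup

/-- An infinite finitely generated commutative normal subgroup of finite index has a proper
supplement of finite index containing a subgroup of powers. -/
theorem exists_powSubgroup_le_sup_eq_top {G : Type*} [Group G] (A : Subgroup G) [A.Normal]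
    [IsMulCommutative A] [Group.FG A] [Infinite A] [A.FiniteIndex] :
    ∃ p ≠ 0, ∃ M : Subgroup G, M ≠ ⊤ ∧ M.FiniteIndex ∧ powSubgroup A p ≤ M ∧ A ⊔ M = ⊤ := by
  obtain ⟨p, hpA, hp⟩ := Nat.exists_infinite_primes (A.index + 1)
  obtain ⟨k, hk⟩ := exists_powSubgroup_relIndex_eq A hp
  let π := QuotientGroup.mk' (powSubgroup A p)
  have hπ : Function.Surjective π := QuotientGroup.mk'_surjective _
  have hker : π.ker = powSubgroup A p := QuotientGroup.ker_mk' _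
  have : (A.map π).Normal := Subgroup.Normal.map inferInstance π hπ
  have hindex : (A.map π).index = A.index :=
    A.index_map_eq hπ (hker.trans_le (powSubgroup_le A p))
  have hcard : Nat.card (A.map π) = p ^ k := by
    rw [← hk, ← Subgroup.relIndex_ker, hker]
  obtain ⟨H, hH⟩ := Subgroup.exists_right_complement'_of_coprime (N := A.map π) (by
    rw [hcard, hindex]
    refine Nat.Coprime.pow_left _ ((Nat.Prime.coprime_iff_not_dvd hp).2 fun hdvd ↦ ?_)
    have := Nat.le_of_dvd (Nat.pos_of_ne_zero Subgroup.FiniteIndex.index_ne_zero) hdvd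
    omega)
  have hM : (H.comap π).index = p ^ k := by
    rw [Subgroup.index_comap_of_surjective _ hπ, hH.index_eq_card, hcard]
  refine ⟨p, hp.ne_zero, H.comap π, fun htop ↦ ?_, ⟨by simp [hM, hp.ne_zero]⟩, ?_, ?_⟩
  · rw [htop, Subgroup.index_top, ← hk, eq_comm, Subgroup.relIndex_eq_one] at hM
    exact powSubgroup_ne_self A hp (le_antisymm (powSubgroup_le A p) hM)
  · exact hker.ge.trans (H.ker_le_comap π)
  · rw [← Subgroup.comap_map_eq_self (f := π) (H := A ⊔ H.comap π)
      ((H.ker_le_comap π).trans le_sup_right), Subgroup.map_sup,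
      Subgroup.map_comap_eq_self_of_surjective hπ, hH.sup_eq_top, Subgroup.comap_top]

section commutator

open scoped commutatorElement

variable {G : Type*} [Group G] {A : Subgroup G} [A.Normal] [IsMulCommutative A]

omit [A.Normal] in
theorem commute_of_mem_isMulCommutative {a b : G} (ha : a ∈ A) (hb : b ∈ A) : a * b = b * a :=
  congrArg Subtype.val (mul_comm (⟨a, ha⟩ : A) ⟨b, hb⟩)

omit [IsMulCommutative A] in
theorem commutatorElement_mem_of_normal {a : G} (ha : a ∈ A) (x : G) : ⁅a, x⁆ ∈ A := by
  rw [commutatorElement_def, mul_assoc, mul_assoc, ← mul_assoc x]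
  exact mul_mem ha ((inferInstance : A.Normal).conj_mem _ (inv_mem ha) x)

theorem commutatorElement_pow_of_mem {a : G} (ha : a ∈ A) (x : G) (m : ℕ) :
    ⁅a ^ m, x⁆ = ⁅a, x⁆ ^ m := by
  induction m with
  | zero => simp
  | succ m ih =>
    have h1 := commute_of_mem_isMulCommutative (pow_mem ha m) (commutatorElement_mem_of_normal ha x)
    rw [pow_succ, commutatorElement_mul_left_eq_conj_mul, h1, mul_inv_cancel_right, ih, pow_succ']

omit [IsMulCommutative A] in
theorem iterate_commutatorElement_mem {a : G} (ha : a ∈ A) (x : G) (k : ℕ) :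
    (fun y ↦ ⁅y, x⁆)^[k] a ∈ A := by
  induction k with
  | zero => exact ha
  | succ k ih =>
    rw [Function.iterate_succ_apply']
    exact commutatorElement_mem_of_normal ih x

theorem iterate_commutatorElement_pow {a : G} (ha : a ∈ A) (x : G) (m k : ℕ) :
    (fun y ↦ ⁅y, x⁆)^[k] (a ^ m) = (fun y ↦ ⁅y, x⁆)^[k] a ^ m := by
  induction k with
  | zero => rfl
  | succ k ih =>
    rw [Function.iterate_succ_apply', ih, Function.iterate_succ_apply',
      commutatorElement_pow_of_mem (iterate_commutatorElement_mem ha x k)]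

omit [IsMulCommutative A] in
theorem iterate_commutatorElement_mem_lowerCentralSeries {M : Subgroup G} {a x : G} (ha : a ∈ M)
    (hx : x ∈ M) (k : ℕ) : (fun y ↦ ⁅y, x⁆)^[k] a ∈ M.lowerCentralSeries k := by
  induction k with
  | zero => exact ha
  | succ k ih =>
    rw [Function.iterate_succ_apply']
    exact Subgroup.commutator_mem_commutator ih hx

theorem commutatorElement_eq_one_of_commutatorElement_eq_one [A.FiniteIndex]
    (htf : ∀ x ∈ A, IsOfFinOrder x → x = 1) {a x : G} (ha : a ∈ A) (h : ⁅⁅a, x⁆, x⁆ = 1) :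
    ⁅a, x⁆ = 1 := by
  refine htf _ (commutatorElement_mem_of_normal ha x) (isOfFinOrder_iff_pow_eq_one.2
    ⟨A.index, Nat.pos_of_ne_zero Subgroup.FiniteIndex.index_ne_zero, ?_⟩)
  have h1 : (a * x * a⁻¹) ^ A.index = ⁅a, x⁆ ^ A.index * x ^ A.index := by
    rw [← (commutatorElement_eq_one_iff_commute.1 h).mul_pow, commutatorElement_def,
      inv_mul_cancel_right]
  rw [conj_pow, commute_of_mem_isMulCommutative ha (A.pow_index_mem x), mul_inv_cancel_right] at h1
  exact (right_eq_mul.1 h1)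

theorem commutatorElement_eq_one_of_iterate [A.FiniteIndex]
    (htf : ∀ x ∈ A, IsOfFinOrder x → x = 1) {x : G} (k : ℕ) {a : G} (ha : a ∈ A)
    (h : (fun y ↦ ⁅y, x⁆)^[k] a = 1) : ⁅a, x⁆ = 1 := by
  induction k generalizing a with
  | zero => rw [show a = 1 from h, commutatorElement_one_left]
  | succ k ih =>
    exact commutatorElement_eq_one_of_commutatorElement_eq_one htf ha
      (ih (commutatorElement_mem_of_normal ha x) h)

/-- If every proper subgroup of finite index is nilpotent, then an infinite finitely generated
torsion-free commutative normal subgroup of finite index is central. -/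
theorem le_center_of_isNilpotent_finiteIndex [Group.FG A] [Infinite A] [A.FiniteIndex]
    (htf : ∀ x ∈ A, IsOfFinOrder x → x = 1)
    (hG : ∀ H : Subgroup G, H ≠ ⊤ → H.FiniteIndex → Group.IsNilpotent H) :
    A ≤ Subgroup.center G := by
  obtain ⟨p, hp, M, hM, hfin, hle, hsup⟩ := exists_powSubgroup_le_sup_eq_top A
  obtain ⟨c, hc⟩ := M.isNilpotent_iff_lowerCentralSeries.1 (hG M hM hfin)
  intro a ha
  rw [Subgroup.mem_center_iff]
  intro g
  obtain ⟨b, hb, x, hx, rfl⟩ := Subgroup.mem_sup_of_normal_left.1 (hsup ▸ Subgroup.mem_top g)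
  have h1 : (fun y ↦ ⁅y, x⁆)^[c] a ^ p = 1 := by
    rw [← iterate_commutatorElement_pow ha, ← Subgroup.mem_bot, ← hc]
    exact iterate_commutatorElement_mem_lowerCentralSeries
      (hle ((mem_powSubgroup A).2 ⟨a, ha, rfl⟩)) hx c
  have h2 := htf _ (iterate_commutatorElement_mem ha x c)
    (isOfFinOrder_iff_pow_eq_one.2 ⟨p, Nat.pos_of_ne_zero hp, h1⟩)
  have h3 : Commute a x :=
    commutatorElement_eq_one_iff_commute.1 (commutatorElement_eq_one_of_iterate htf c ha h2)
  have h4 : Commute a b := commute_of_mem_isMulCommutative ha hb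
  exact (h4.mul_right h3).symm

variable (A) in
theorem infinite_abelianization_of_isMulCommutative [Group.FG G] [Infinite G] [A.FiniteIndex]
    (hG : ∀ H : Subgroup G, H ≠ ⊤ → H.FiniteIndex → Group.IsNilpotent H) :
    Infinite (Abelianization G) := by
  obtain ⟨e, he, htf⟩ := exists_powSubgroup_isMulTorsionFree A
  let B := powSubgroup A e
  have : IsMulCommutative B := ⟨⟨fun a b ↦ Subtype.ext (commute_of_mem_isMulCommutative
    (powSubgroup_le A e a.2) (powSubgroup_le A e b.2))⟩⟩
  have : B.FiniteIndex := ⟨by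
    rw [← Subgroup.relIndex_mul_index (powSubgroup_le A e)]
    exact mul_ne_zero (powSubgroup_relIndex_ne_zero A he) Subgroup.FiniteIndex.index_ne_zero⟩
  have : Infinite B := by
    by_contra hB
    rw [not_infinite_iff_finite] at hB
    exact not_finite_iff_infinite.2 ‹Infinite G› (finite_of_finite_of_finiteIndex B)
  have hB : B ≤ Subgroup.center G := le_center_of_isNilpotent_finiteIndex htf hG
  have : (Subgroup.center G).FiniteIndex := Subgroup.finiteIndex_of_le hB
  by_contra h
  rw [not_infinite_iff_finite] at h
  exact not_finite_iff_infinite.2 ‹Infinite G›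
    finite_of_finite_abelianization_of_finiteIndex_center

end commutator

end IsMulCommutative

theorem isNilpotent_quotient_of_finiteIndex {G : Type*} [Group G] (K : Subgroup G) [K.Normal]
    (hG : ∀ H : Subgroup G, H ≠ ⊤ → H.FiniteIndex → Group.IsNilpotent H)
    (H : Subgroup (G ⧸ K)) (hH : H ≠ ⊤) (hfin : H.FiniteIndex) : Group.IsNilpotent H := by
  have hπ := QuotientGroup.mk'_surjective K
  have := hG (H.comap (QuotientGroup.mk' K))
    (fun h ↦ hH (Subgroup.comap_injective hπ (h.trans (Subgroup.comap_top _).symm)))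
    ⟨by rw [Subgroup.index_comap_of_surjective _ hπ]; exact hfin.index_ne_zero⟩
  exact Group.nilpotent_of_surjective ((QuotientGroup.mk' K).subgroupComap H)
    ((QuotientGroup.mk' K).subgroupComap_surjective_of_surjective H hπ)

/-- An infinite finitely generated virtually nilpotent group whose proper subgroups of finite
index are nilpotent is nilpotent. -/
theorem isNilpotent_of_infinite_of_finiteIndex {G : Type*} [Group G] [Group.FG G] [Infinite G]
    (N : Subgroup G) [N.Normal] [N.FiniteIndex] [Group.IsNilpotent N]
    (hG : ∀ H : Subgroup G, H ≠ ⊤ → H.FiniteIndex → Group.IsNilpotent H) :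
    Group.IsNilpotent G := by
  let π := QuotientGroup.mk' ⁅N, N⁆
  have hπ : Function.Surjective π := QuotientGroup.mk'_surjective _
  have hker : π.ker = ⁅N, N⁆ := QuotientGroup.ker_mk' _
  have : (N.map π).Normal := Subgroup.Normal.map inferInstance π hπ
  have : IsMulCommutative (N.map π) := by
    rw [← Subgroup.commutator_self_eq_bot_iff, ← Subgroup.map_commutator,
      Subgroup.map_eq_bot_iff, hker]
  have : (N.map π).FiniteIndex := ⟨by
    rw [N.index_map_eq hπ (hker.trans_le N.commutator_le_self)]
    exact Subgroup.FiniteIndex.index_ne_zero⟩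
  have : Infinite (G ⧸ ⁅N, N⁆) := by
    by_contra h
    rw [not_infinite_iff_finite] at h
    have h1 : (commutator N).index ≠ 0 := by
      have h2 : ⁅N, N⁆.subgroupOf N = commutator N := by
        rw [← N.map_subtype_commutator, Subgroup.subgroupOf,
          Subgroup.comap_map_eq_self_of_injective N.subtype_injective]
      have h3 : ⁅N, N⁆.relIndex N = Nat.card (N.map π) := by
        rw [← Subgroup.relIndex_ker, hker]
      rw [← h2, ← Subgroup.relIndex, h3]
      exact Nat.card_pos.ne'
    have : Finite (Abelianization N) := Nat.finite_of_card_ne_zero h1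
    have : Finite N := finite_of_isNilpotent_of_finite_abelianization inferInstance this
    exact not_finite_iff_infinite.2 ‹Infinite G› (finite_of_finite_of_finiteIndex N)
  have := infinite_abelianization_of_isMulCommutative (N.map π)
    (isNilpotent_quotient_of_finiteIndex ⁅N, N⁆ hG)
  have hab : Function.Surjective (Abelianization.of (G := G ⧸ ⁅N, N⁆)) :=
    QuotientGroup.mk'_surjective _
  have : Group.FG (Abelianization (G ⧸ ⁅N, N⁆)) := Group.fg_of_surjective hab
  obtain ⟨f, hf⟩ := exists_surjective_multiplicative_int (A := Abelianization (G ⧸ ⁅N, N⁆))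
  refine isNilpotent_of_surjective_multiplicative_int hG ((f.comp Abelianization.of).comp π) ?_
  exact (hf.comp hab).comp hπ

theorem LocallyGraded.subgroup {G : Type*} [Group G] (hG : LocallyGraded G) (S : Subgroup G) :
    LocallyGraded S := by
  intro H hH hfg
  have e : H ≃* H.map S.subtype := H.equivMapOfInjective _ S.subtype_injective
  have : Group.FG (H.map S.subtype) := Group.fg_of_surjective (f := e.toMonoidHom) e.surjective
  obtain ⟨K, hK, hfin⟩ := hG (H.map S.subtype)
    (fun h ↦ hH ((Subgroup.map_eq_bot_iff_of_injective _ S.subtype_injective).1 h)) this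
  refine ⟨K.comap e.toMonoidHom, fun h ↦ hK ?_, ⟨?_⟩⟩
  · exact Subgroup.comap_injective e.surjective (h.trans (Subgroup.comap_top _).symm)
  · rw [Subgroup.index_comap_of_surjective _ e.surjective]
    exact hfin.index_ne_zero

theorem LocallyGraded.exists_normal_finiteIndex {G : Type*} [Group G] [Nontrivial G] [Group.FG G]
    (hG : LocallyGraded G) : ∃ N : Subgroup G, N ≠ ⊤ ∧ N.Normal ∧ N.FiniteIndex := by
  obtain ⟨K, hK, hfin⟩ := hG ⊤ top_ne_bot inferInstance
  let e : G ≃* (⊤ : Subgroup G) := Subgroup.topEquiv.symm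
  have : (K.comap e.toMonoidHom).FiniteIndex := ⟨by
    rw [Subgroup.index_comap_of_surjective _ e.surjective]
    exact hfin.index_ne_zero⟩
  refine ⟨(K.comap e.toMonoidHom).normalCore, fun h ↦ hK ?_, inferInstance, inferInstance⟩
  exact Subgroup.comap_injective e.surjective
    ((top_le_iff.1 (h.ge.trans (Subgroup.normalCore_le _))).trans (Subgroup.comap_top _).symm)

/-- A finitely generated locally graded non-nilpotent group whose proper subgroups of finite index
are nilpotent is finite. -/
theorem LocallyGraded.finite_of_finiteIndex_isNilpotent {G : Type*} [Group G] [Group.FG G]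
    (hlg : LocallyGraded G) (hn : ¬ Group.IsNilpotent G)
    (hG : ∀ H : Subgroup G, H ≠ ⊤ → H.FiniteIndex → Group.IsNilpotent H) : Finite G := by
  by_contra h
  rw [not_finite_iff_infinite] at h
  obtain ⟨N, hN, _, hfin⟩ := hlg.exists_normal_finiteIndex
  have := hG N hN hfin
  exact hn (isNilpotent_of_infinite_of_finiteIndex N hG)

theorem MinimalNonNilpotent.finite {G : Type*} [Group G] [Group.FG G] (hlg : LocallyGraded G)
    (hG : MinimalNonNilpotent G) : Finite G :=
  hlg.finite_of_finiteIndex_isNilpotent hG.1 fun H hH _ ↦ hG.2 H hH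

theorem BiminimalNonNilpotent.finite {G : Type*} [Group G] [Group.FG G] (hlg : LocallyGraded G)
    (hG : BiminimalNonNilpotent G) : Finite G := by
  by_cases h : ∀ H : Subgroup G, H ≠ ⊤ → H.FiniteIndex → Group.IsNilpotent H
  · exact hlg.finite_of_finiteIndex_isNilpotent hG.1 h
  · push Not at h
    obtain ⟨H, hH, hfin, hn⟩ := h
    have : Finite H := ((hG.2.2 H hH).resolve_left hn).finite (hlg.subgroup H)
    exact finite_of_finite_of_finiteIndex H

/-- A biminimal non-nilpotent group with a finitely generated non-nilpotent subgroup is finitely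
generated. -/
theorem BiminimalNonNilpotent.fg {G : Type*} [Group G] (hG : BiminimalNonNilpotent G)
    {X : Subgroup G} (hfg : Group.FG X) (hX : ¬ Group.IsNilpotent X) : Group.FG G := by
  rw [Group.fg_iff_subgroup_fg] at hfg
  by_contra hn
  have hle : ∀ x, x ∈ X := by
    intro x
    have hfg' : (X ⊔ Subgroup.zpowers x).FG := hfg.sup ⟨{x}, by
      rw [Finset.coe_singleton, Subgroup.zpowers_eq_closure]⟩
    have hne : X ⊔ Subgroup.zpowers x ≠ ⊤ := fun h ↦ hn ⟨h ▸ hfg'⟩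
    by_contra hx
    rcases hG.2.2 _ hne with hnil | hmin
    · exact hX (Group.nilpotent_of_mulEquiv (Subgroup.subgroupOfEquivOfLe
        (le_sup_left : X ≤ X ⊔ Subgroup.zpowers x)))
    · refine hX ?_
      have := hmin.2 (X.subgroupOf (X ⊔ Subgroup.zpowers x)) fun h ↦ hx
        (Subgroup.subgroupOf_eq_top.1 h (le_sup_right (a := X) (Subgroup.mem_zpowers x)))
      exact Group.nilpotent_of_mulEquiv (Subgroup.subgroupOfEquivOfLe
        (le_sup_left : X ≤ X ⊔ Subgroup.zpowers x))
  have hX' : X = ⊤ := top_le_iff.1 fun x _ ↦ hle x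
  exact hn ⟨hX' ▸ hfg⟩

/-- A locally graded biminimal non-nilpotent group with a finitely generated
non-nilpotent subgroup is finite. -/
theorem stmt_15 {G : Type*} [Group G] (hlg : LocallyGraded G)
    (hbi : BiminimalNonNilpotent G)
    (hX : ∃ X : Subgroup G, Group.FG X ∧ ¬ Group.IsNilpotent X) :
    Finite G := by
  obtain ⟨X, hfg, hn⟩ := hX
  have := hbi.fg hfg hn
  exact hbi.finite hlg
end

section
/- Let G be an infinite locally graded group in which every subgroup is either nilpotent or minimal non-nilpotent. Then G is locally nilpotent. -/
section

open Subgroup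
open scoped commutatorElement

/-- If `G` is generated by `H` and a normal subgroup `M`, then an element of the `j`-th centre of `H`
which is central modulo `Z_c(G)` with respect to `M` lies in `Z_{c+j}(G)`. -/
theorem Subgroup.mem_upperCentralSeries_of_mem_of_sup_eq_top {G : Type*} [Group G]
    {H M : Subgroup G} [M.Normal] (hHM : H ⊔ M = ⊤) {c : ℕ} (j : ℕ) (w : H)
    (hw : w ∈ Subgroup.upperCentralSeries H j)
    (hM : ∀ m ∈ M, ⁅(w : G), m⁆ ∈ Subgroup.upperCentralSeries G c) :
    (w : G) ∈ Subgroup.upperCentralSeries G (c + j) := by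
  let S : Subgroup G := (centralizer ((M.map (QuotientGroup.mk' (Subgroup.upperCentralSeries G c)) :
    Subgroup (G ⧸ Subgroup.upperCentralSeries G c)) : Set _)).comap
      (QuotientGroup.mk' (Subgroup.upperCentralSeries G c))
  have : (M.map (QuotientGroup.mk' (Subgroup.upperCentralSeries G c))).Normal :=
    Normal.map ‹_› _ (QuotientGroup.mk'_surjective _)
  have hSn : S.Normal := inferInstance
  have hS : ∀ x, x ∈ S ↔ ∀ m ∈ M, ⁅x, m⁆ ∈ Subgroup.upperCentralSeries G c := by
    intro x
    simp only [S, mem_comap, mem_centralizer_iff, SetLike.mem_coe, mem_map,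
      forall_exists_index, and_imp, forall_apply_eq_imp_iff₂]
    refine forall₂_congr fun m _ => ?_
    rw [eq_comm, ← commutatorElement_eq_one_iff_mul_comm, ← map_commutatorElement,
      ← MonoidHom.mem_ker, QuotientGroup.ker_mk']
  rw [← hS] at hM
  induction j generalizing w with
  | zero =>
    have : w = 1 := by simpa using hw
    simp [this, one_mem]
  | succ j ih =>
    rw [← add_assoc, Subgroup.mem_upperCentralSeries_succ_iff]
    intro g
    obtain ⟨h, hh, m, hm, rfl⟩ := Subgroup.mem_sup_of_normal_right.1 (hHM ▸ mem_top g)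
    have e : ⁅(w : G), h * m⁆ = ⁅(w : G), h⁆ * (h * ⁅(w : G), m⁆ * h⁻¹) := by
      simp only [commutatorElement_def]; group
    rw [e]
    refine mul_mem (ih ⁅w, ⟨h, hh⟩⁆ (Subgroup.mem_upperCentralSeries_succ_iff.1 hw _) ?_)
      (Normal.conj_mem inferInstance _
        (Subgroup.upperCentralSeries_mono G (Nat.le_add_right c j) ((hS _).1 hM m hm)) _)
    rw [show ((⁅w, ⟨h, hh⟩⁆ : H) : G) = w * (h * (w : G)⁻¹ * h⁻¹) by
      simp [commutatorElement_def, mul_assoc]]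
    exact mul_mem hM (hSn.conj_mem _ (inv_mem hM) _)

/-- A group is nilpotent if it has a nilpotent normal subgroup `M` and two nilpotent supplements of
`M` containing, respectively, the `p`-th and the `q`-th powers of elements of `M`, for coprime
`p` and `q`. -/
theorem Group.isNilpotent_of_coprime_pow_mem {G : Type*} [Group G] {M H₁ H₂ : Subgroup G}
    [M.Normal] [Group.IsNilpotent M] [Group.IsNilpotent H₁] [Group.IsNilpotent H₂]
    (h₁ : H₁ ⊔ M = ⊤) (h₂ : H₂ ⊔ M = ⊤) {p q : ℕ} (hpq : p.Coprime q)
    (hp : ∀ m ∈ M, m ^ p ∈ H₁) (hq : ∀ m ∈ M, m ^ q ∈ H₂) : Group.IsNilpotent G := by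
  obtain ⟨d₁, hd₁⟩ := Group.IsNilpotent.nilpotent H₁
  obtain ⟨d₂, hd₂⟩ := Group.IsNilpotent.nilpotent H₂
  obtain ⟨n, hn⟩ := Group.IsNilpotent.nilpotent M
  have key : ∀ i, ∃ c, ∀ w ∈ Subgroup.upperCentralSeries M i,
      (w : G) ∈ Subgroup.upperCentralSeries G c := by
    intro i
    induction i with
    | zero => exact ⟨0, fun w hw => by simpa using hw⟩
    | succ i ih =>
      obtain ⟨c, hc⟩ := ih
      have comm : ∀ w ∈ Subgroup.upperCentralSeries M (i + 1), ∀ m ∈ M,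
          ⁅(w : G), m⁆ ∈ Subgroup.upperCentralSeries G c := fun w hw m hm =>
        hc ⁅w, ⟨m, hm⟩⁆ (Subgroup.mem_upperCentralSeries_succ_iff.1 hw _)
      refine ⟨c + d₁ + d₂, fun w hw => ?_⟩
      have e₁ : (w : G) ^ p ∈ Subgroup.upperCentralSeries G (c + d₁ + d₂) :=
        Subgroup.upperCentralSeries_mono G (by omega) <|
          mem_upperCentralSeries_of_mem_of_sup_eq_top (c := c) h₁ d₁ ⟨_, hp w w.2⟩ (by simp [hd₁])
            (comm (w ^ p) (pow_mem hw p))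
      have e₂ : (w : G) ^ q ∈ Subgroup.upperCentralSeries G (c + d₁ + d₂) :=
        Subgroup.upperCentralSeries_mono G (by omega) <|
          mem_upperCentralSeries_of_mem_of_sup_eq_top (c := c) h₂ d₂ ⟨_, hq w w.2⟩ (by simp [hd₂])
            (comm (w ^ q) (pow_mem hw q))
      have e := mul_mem (zpow_mem e₁ (p.gcdA q)) (zpow_mem e₂ (p.gcdB q))
      have := Nat.gcd_eq_gcd_ab p q
      rw [hpq.gcd_eq_one] at this
      rwa [← zpow_natCast, ← zpow_natCast, ← zpow_mul, ← zpow_mul, ← zpow_add, ← this,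
        Nat.cast_one, zpow_one] at e
  obtain ⟨c, hc⟩ := key n
  have hM : M ≤ Subgroup.upperCentralSeries G c := fun m hm => hc ⟨m, hm⟩ (by simp [hn])
  refine ⟨c + d₁, top_le_iff.1 (h₁ ▸ sup_le (fun h hh => ?_)
    (hM.trans (Subgroup.upperCentralSeries_mono G (Nat.le_add_right _ _))))⟩
  refine mem_upperCentralSeries_of_mem_of_sup_eq_top h₁ d₁ ⟨h, hh⟩ (by simp [hd₁]) fun m hm => ?_
  rw [commutatorElement_def]
  exact mul_mem (Normal.conj_mem inferInstance _ (hM hm) h) (inv_mem (hM hm))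

/-- A finitely generated infinite abelian group is not divisible by any `q ≠ 1`. -/
theorem CommGroup.range_powMonoidHom_ne_top {A : Type*} [CommGroup A] [Group.FG A] [Infinite A]
    {q : ℕ} (hq : q ≠ 1) : (powMonoidHom q : A →* A).range ≠ ⊤ := by
  intro h
  have hfin : Module.Finite ℤ (Additive A) := Module.Finite.iff_addGroup_fg.2 inferInstance
  obtain ⟨r, hr, hr0⟩ := Submodule.exists_sub_one_mem_and_smul_eq_zero_of_fg_of_le_smul
    (Ideal.span {(q : ℤ)}) (⊤ : Submodule ℤ (Additive A)) hfin.1 (by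
      intro a _
      obtain ⟨b, hb⟩ := (h ▸ mem_top a.toMul : a.toMul ∈ (powMonoidHom q : A →* A).range)
      have : a = (q : ℤ) • Additive.ofMul b := by
        apply Additive.toMul.injective
        simpa using hb.symm
      rw [this]
      exact Submodule.smul_mem_smul (Ideal.mem_span_singleton_self _) trivial)
  have hr' : r ≠ 0 := by
    rintro rfl
    rw [Ideal.mem_span_singleton] at hr
    have := Int.natAbs_dvd_natAbs.2 hr
    simp at this
    exact hq this
  refine not_finite_iff_infinite.2 ‹Infinite A› (CommGroup.finite_of_fg_isMulTorsion A ?_)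
  exact fun a => isOfFinOrder_iff_zpow_eq_one.2 ⟨r, hr', hr0 (Additive.ofMul a) trivial⟩

/-- A nilpotent group with finite abelianization is finite. -/
theorem Group.finite_of_finite_abelianization (G : Type*) [Group G] [Group.IsNilpotent G]
    (hab : Finite (Abelianization G)) : Finite G := by
  revert hab
  refine Group.nilpotent_center_quotient_ind
    (P := fun G _ _ => Finite (Abelianization G) → Finite G) G (fun G _ _ _ => inferInstance) ?_
  intro G _ _ ih hab
  have hs : Function.Surjective (Abelianization.map (QuotientGroup.mk' (center G))) := by
    intro x
    obtain ⟨y, rfl⟩ := QuotientGroup.mk_surjective x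
    obtain ⟨z, rfl⟩ := QuotientGroup.mk_surjective y
    exact ⟨Abelianization.of z, rfl⟩
  have := ih (Finite.of_surjective _ hs)
  have : Finite (commutatorSet G) := by
    refine ((Set.finite_range (fun x : (G ⧸ center G) × (G ⧸ center G) => ⁅x.1.out, x.2.out⁆)).subset
      ?_).to_subtype
    rintro _ ⟨a, b, rfl⟩
    refine ⟨(a, b), ?_⟩
    obtain ⟨⟨z, hz⟩, ha⟩ := QuotientGroup.mk_out_eq_mul (center G) a
    obtain ⟨⟨w, hw⟩, hb⟩ := QuotientGroup.mk_out_eq_mul (center G) b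
    have hz' := mem_center_iff.1 hz
    have hw' := mem_center_iff.1 hw
    simp only [ha, hb]
    calc ⁅a * z, b * w⁆ = a * (z * (b * w) * z⁻¹) * a⁻¹ * w⁻¹ * b⁻¹ := by
          simp only [commutatorElement_def]; group
      _ = a * b * (w * a⁻¹ * w⁻¹) * b⁻¹ := by rw [← hz', mul_inv_cancel_right]; group
      _ = ⁅a, b⁆ := by rw [← hw', mul_inv_cancel_right, commutatorElement_def]
  have h : Finite (G ⧸ _root_.commutator G) := hab
  exact Finite.of_subgroup_quotient (_root_.commutator G)

/-- A finitely generated infinite nilpotent group has a proper characteristic subgroup of finite index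
containing all `q`-th powers. -/
theorem Group.exists_characteristic_pow_mem (N : Type*) [Group N] [Group.FG N]
    [Group.IsNilpotent N] [Infinite N] {q : ℕ} (hq : 1 < q) :
    ∃ K : Subgroup N, K.Characteristic ∧ K ≠ ⊤ ∧ K.FiniteIndex ∧ ∀ x, x ^ q ∈ K := by
  have hA : Infinite (Abelianization N) := by
    by_contra h
    have := Group.finite_of_finite_abelianization N (not_infinite_iff_finite.1 h)
    exact not_finite N
  have hof : Function.Surjective (Abelianization.of (G := N)) := QuotientGroup.mk_surjective
  have : Group.FG (Abelianization N) := Group.fg_of_surjective hof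
  let R := (powMonoidHom q : Abelianization N →* Abelianization N).range
  have hR : R.FiniteIndex := by
    have : Finite (Abelianization N ⧸ R) := by
      apply CommGroup.finite_of_fg_isMulTorsion
      intro x
      obtain ⟨a, rfl⟩ := QuotientGroup.mk_surjective x
      refine isOfFinOrder_iff_pow_eq_one.2 ⟨q, by omega, ?_⟩
      rw [← QuotientGroup.mk_pow, QuotientGroup.eq_one_iff]
      exact ⟨a, rfl⟩
    exact finiteIndex_of_finite_quotient
  refine ⟨R.comap Abelianization.of, ?_, ?_, ⟨by
    rw [index_comap_of_surjective _ hof]; exact hR.index_ne_zero⟩,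
    fun x => ⟨Abelianization.of x, by simp⟩⟩
  · refine characteristic_iff_le_comap.2 fun φ x hx => ?_
    obtain ⟨a, ha⟩ := hx
    exact ⟨Abelianization.map φ.toMonoidHom a, by
      simpa using congrArg (Abelianization.map φ.toMonoidHom) ha⟩
  · rw [← comap_top Abelianization.of]
    exact fun h => CommGroup.range_powMonoidHom_ne_top (by omega) (comap_injective hof h)

/-- A finitely generated infinite nilpotent normal subgroup of finite index prime to `q` has a proper
supplement containing its `q`-th powers. -/
theorem Subgroup.exists_sup_eq_top_pow_mem {G : Type*} [Group G] (N : Subgroup G) [N.Normal]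
    [N.FiniteIndex] [Group.FG N] [Group.IsNilpotent N] [Infinite N] {q : ℕ} (hq : q.Prime)
    (hqN : q.Coprime N.index) :
    ∃ H : Subgroup G, H ≠ ⊤ ∧ H ⊔ N = ⊤ ∧ ∀ n ∈ N, n ^ q ∈ H := by
  obtain ⟨K, hK, hKt, hKf, hKq⟩ := Group.exists_characteristic_pow_mem N hq.one_lt
  let L : Subgroup G := K.map N.subtype
  have hLN : L ≤ N := map_subtype_le K
  have hL : L.FiniteIndex := ⟨by
    simp only [L, index_map_subtype]
    exact mul_ne_zero hKf.index_ne_zero FiniteIndex.index_ne_zero⟩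
  have hpow : ∀ n ∈ N, n ^ q ∈ L := fun n hn => ⟨_, hKq ⟨n, hn⟩, rfl⟩
  have hLn : L.Normal := inferInstance
  let f := QuotientGroup.mk' L
  have hf : Function.Surjective f := QuotientGroup.mk'_surjective L
  have hker : f.ker = L := QuotientGroup.ker_mk' L
  have hVn : (N.map f).Normal := Normal.map ‹_› f hf
  have hcop : (Nat.card (N.map f)).Coprime (N.map f).index := by
    have hp : IsPGroup q (N.map f) := by
      rintro ⟨_, n, hn, rfl⟩
      refine ⟨1, Subtype.ext ?_⟩
      simpa [← map_pow, ← MonoidHom.mem_ker, hker] using hpow n hn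
    obtain ⟨k, hk⟩ := hp.exists_card_dvd_pow
    rw [index_map_eq N hf (hker.le.trans hLN)]
    exact (hqN.pow_left k).of_dvd_left hk
  obtain ⟨C, hC⟩ := exists_right_complement'_of_coprime hcop
  have hcomap : (N.map f).comap f = N := by
    rw [comap_map_eq, hker, sup_eq_left.2 hLN]
  refine ⟨C.comap f, fun h => hKt ?_, ?_, fun n hn => ?_⟩
  · rw [← comap_top f] at h
    have hbot : N.map f = ⊥ := by
      have := hC.disjoint
      rwa [comap_injective hf h, disjoint_top] at this
    rw [(Subgroup.map_eq_bot_iff N), hker] at hbot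
    rw [eq_top_iff]
    intro x _
    obtain ⟨y, hy, hyx⟩ := hbot x.2
    rwa [← Subtype.ext hyx]
  · rw [← hcomap, comap_sup_eq f _ _ hf, sup_comm, hC.sup_eq_top, comap_top]
  · have : f (n ^ q) = 1 := by
      rw [← MonoidHom.mem_ker, hker]; exact hpow n hn
    simp only [mem_comap, this, one_mem]

/-- A finitely generated infinite group with nilpotent proper subgroups, at least one of which has
finite index, is nilpotent. -/
theorem Group.isNilpotent_of_finiteIndex_of_forall_ne_top {G : Type*} [Group G] [Group.FG G]
    [Infinite G] (hG : ∃ K : Subgroup G, K ≠ ⊤ ∧ K.FiniteIndex)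
    (hsub : ∀ H : Subgroup G, H ≠ ⊤ → Group.IsNilpotent H) : Group.IsNilpotent G := by
  obtain ⟨K, hK, hKf⟩ := hG
  let N := K.normalCore
  have : Group.IsNilpotent N := hsub N fun h => hK (top_le_iff.1 (h ▸ K.normalCore_le))
  have : Group.FG N := fg_of_index_ne_zero N
  have : Infinite N := by
    by_contra h
    have := not_infinite_iff_finite.1 h
    have : Finite (G ⧸ N) := inferInstance
    have := Finite.of_subgroup_quotient N
    exact not_finite G
  obtain ⟨p, hpN, hp⟩ := Nat.exists_infinite_primes (N.index + 1)
  obtain ⟨q, hqp, hq⟩ := Nat.exists_infinite_primes (p + 1)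
  have hN0 : N.index ≠ 0 := FiniteIndex.index_ne_zero
  obtain ⟨H₁, h₁t, h₁, h₁p⟩ := N.exists_sup_eq_top_pow_mem hp
    (Nat.coprime_of_lt_prime hN0 (by omega) hp)
  obtain ⟨H₂, h₂t, h₂, h₂p⟩ := N.exists_sup_eq_top_pow_mem hq
    (Nat.coprime_of_lt_prime hN0 (by omega) hq)
  have := hsub H₁ h₁t
  have := hsub H₂ h₂t
  exact Group.isNilpotent_of_coprime_pow_mem h₁ h₂
    ((Nat.coprime_primes hp hq).2 (by omega)) h₁p h₂p

end

/-- An infinite locally graded group whose subgroups are all either nilpotent or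
minimal non-nilpotent is locally nilpotent. -/
theorem stmt_16 {G : Type*} [Group G] (hinf : Infinite G) (hlg : LocallyGraded G)
    (hsub : ∀ H : Subgroup G, Group.IsNilpotent H ∨ MinimalNonNilpotent H) :
    LocallyNilpotent G := by
  rcases hsub ⊤ with h | ⟨hn, h⟩
  · have := Group.isNilpotent_top.1 h
    exact fun H _ => inferInstance
  intro H hH
  by_cases hT : H = ⊤
  · subst hT
    have : Infinite (⊤ : Subgroup G) := Subgroup.topEquiv.toEquiv.infinite_iff.2 hinf
    have hbot : (⊤ : Subgroup G) ≠ ⊥ := by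
      have : Nontrivial G := inferInstance
      exact top_ne_bot
    exact Group.isNilpotent_of_finiteIndex_of_forall_ne_top (hlg ⊤ hbot hH) h
  · have := h (H.subgroupOf ⊤) fun e => hT (top_le_iff.1 (Subgroup.subgroupOf_eq_top.1 e))
    exact (Group.isNilpotent_congr (Subgroup.subgroupOfEquivOfLe le_top)).1 this
end
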